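/- arXiv:1112.1215 — 8 statements merged into one kernel-verified Lean document; each statement's English description precedes it below -/
import Mathlib

section
/- Let S = ((a_1,b_1),…,(a_n,b_n)) be a sequence of pairs of nonnegative integers with ∑_{i=1}^n a_i = ∑_{i=1}^n b_i that is sorted in decreasing lexicographical order, i.e. for all i ∈ {1,…,n−1} either a_i > a_{i+1}, or a_i = a_{i+1} and b_i ≥ b_{i+1}. Then S is a digraph sequence if and only if for every k ∈ {1,…,n}: ∑_{i=1}^{k} min(b_i, k−1) + ∑_{i=k+1}^{n} min(b_i, k) ≥ ∑_{i=1}^{k} a_i. -/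
/-- `S = ((a i, b i))_{i}` is a digraph sequence: there is a digraph (no loops,
no parallel arcs; opposite arcs allowed), given by its boolean adjacency matrix `G`
(`G i j = true` iff there is an arc from `v i` to `v j`), in which vertex `v i` has
indegree `a i` and outdegree `b i`. -/
def IsDigraphSeq {n : ℕ} (a b : Fin n → ℕ) : Prop :=
  ∃ G : Fin n → Fin n → Bool,
    (∀ i, G i i = false) ∧
    (∀ i, (Finset.univ.filter (fun j => G j i = true)).card = a i) ∧
    (∀ i, (Finset.univ.filter (fun j => G i j = true)).card = b i)

/-- A bipartite graph with neighbourhoods `N j` has a subgraph with prescribed degrees `b` on the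
rows and `a` on the columns as soon as every set `T` of columns has enough room. -/
theorem exists_subgraph_of_sum_le_sum_min {α β : Type*} [Fintype α] [Fintype β]
    [DecidableEq α] [DecidableEq β] (N : α → Finset β) (a : β → ℕ) (b : α → ℕ)
    (hsum : ∑ i, a i = ∑ j, b j)
    (hT : ∀ T : Finset β, ∑ i ∈ T, a i ≤ ∑ j, min (b j) (N j ∩ T).card) :
    ∃ M : α → Finset β, (∀ j, M j ⊆ N j) ∧ (∀ j, (M j).card = b j) ∧
      ∀ i, (Finset.univ.filter (fun j => i ∈ M j)).card = a i := by
  classical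
  let t : (Σ i : β, Fin (a i)) ⊕ (Σ j : α, Fin ((N j).card - b j)) → Finset (α × β) :=
    Sum.elim (fun x => Finset.univ.filter fun p => p.2 = x.1 ∧ p.2 ∈ N p.1)
      (fun x => Finset.univ.filter fun p => p.1 = x.1 ∧ p.2 ∈ N p.1)
  have hall : ∀ X : Finset _, X.card ≤ (X.biUnion t).card := by
    intro X
    let T : Finset β := Finset.univ.filter fun i => ∃ s, Sum.inl ⟨i, s⟩ ∈ X
    let R : Finset α := Finset.univ.filter fun j => ∃ s, Sum.inr ⟨j, s⟩ ∈ X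
    have hX : X ⊆ (T.sigma fun _ => Finset.univ).disjSum (R.sigma fun _ => Finset.univ) := by
      rintro (⟨i, s⟩ | ⟨j, s⟩) hx
      · simpa [T] using ⟨s, hx⟩
      · simpa [R] using ⟨s, hx⟩
    have hU : Finset.univ.sigma (fun j => if j ∈ R then N j else N j ∩ T) ⊆
        (X.biUnion t).map (Equiv.sigmaEquivProd α β).symm.toEmbedding := by
      rintro ⟨j, i⟩ hp
      simp only [Finset.mem_sigma, Finset.mem_univ, true_and] at hp
      simp only [Finset.mem_map_equiv, Equiv.symm_symm, Equiv.sigmaEquivProd_apply,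
        Finset.mem_biUnion]
      split_ifs at hp with hj
      · obtain ⟨s, hs⟩ := (Finset.mem_filter.1 hj).2
        exact ⟨_, hs, by simp [t, hp]⟩
      · obtain ⟨hi, hiT⟩ := Finset.mem_inter.1 hp
        obtain ⟨s, hs⟩ := (Finset.mem_filter.1 hiT).2
        exact ⟨_, hs, by simp [t, hi]⟩
    have hX' := Finset.card_le_card hX
    have hU' := Finset.card_le_card hU
    simp only [Finset.card_disjSum, Finset.card_sigma, Finset.card_univ, Fintype.card_fin] at hX'
    rw [Finset.card_map, Finset.card_sigma] at hU'
    refine hX'.trans (le_trans ?_ hU')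
    have hR : ∑ j ∈ R, ((N j).card - b j) = ∑ j, if j ∈ R then (N j).card - b j else 0 := by
      simp [Finset.sum_ite_mem]
    rw [hR]
    refine (Nat.add_le_add_right (hT T) _).trans ?_
    rw [← Finset.sum_add_distrib]
    refine Finset.sum_le_sum fun j _ => ?_
    have := Finset.card_le_card (Finset.inter_subset_left : N j ∩ T ⊆ N j)
    split_ifs <;> omega
  obtain ⟨f, hf, hft⟩ := (Finset.all_card_le_biUnion_card_iff_exists_injective t).1 hall
  have hl : ∀ i s, (f (Sum.inl ⟨i, s⟩)).2 = i ∧ i ∈ N (f (Sum.inl ⟨i, s⟩)).1 := by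
    intro i s
    obtain ⟨h, hN⟩ := (Finset.mem_filter.1 (hft (Sum.inl ⟨i, s⟩))).2
    exact ⟨h, by rwa [h] at hN⟩
  have hr : ∀ j s, (f (Sum.inr ⟨j, s⟩)).1 = j ∧ (f (Sum.inr ⟨j, s⟩)).2 ∈ N j := by
    intro j s
    obtain ⟨h, hN⟩ := (Finset.mem_filter.1 (hft (Sum.inr ⟨j, s⟩))).2
    exact ⟨h, by rwa [h] at hN⟩
  let M : α → Finset β := fun j => Finset.univ.filter fun i => ∃ s, (f (Sum.inl ⟨i, s⟩)).1 = j
  have hMN : ∀ j, M j ⊆ N j := by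
    intro j i hi
    obtain ⟨s, rfl⟩ := (Finset.mem_filter.1 hi).2
    exact (hl i s).2
  have hcol : ∀ i, (Finset.univ.filter (fun j => i ∈ M j)).card = a i := by
    intro i
    have himage : Finset.univ.filter (fun j => i ∈ M j) =
        Finset.univ.image fun s => (f (Sum.inl ⟨i, s⟩)).1 := by
      ext j
      simp [M]
    rw [himage, Finset.card_image_of_injective, Finset.card_univ, Fintype.card_fin]
    intro s s' h
    simpa using hf (Prod.ext h ((hl i s).1.trans (hl i s').1.symm))
  have hrow : ∀ j, (M j).card ≤ b j := by
    intro j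
    let D : Finset β := Finset.univ.image fun s => (f (Sum.inr ⟨j, s⟩)).2
    have hD : D.card = (N j).card - b j := by
      rw [Finset.card_image_of_injective, Finset.card_univ, Fintype.card_fin]
      intro s s' h
      simpa using hf (Prod.ext ((hr j s).1.trans (hr j s').1.symm) h)
    have hDN : D ⊆ N j := by
      intro i hi
      obtain ⟨s, -, rfl⟩ := Finset.mem_image.1 hi
      exact (hr j s).2
    have hdisj : Disjoint (M j) D := by
      rw [Finset.disjoint_left]
      intro i hi hi'
      obtain ⟨s, hs⟩ := (Finset.mem_filter.1 hi).2
      obtain ⟨s', -, hs'⟩ := Finset.mem_image.1 hi'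
      have := hf (Prod.ext (hs.trans (hr j s').1.symm) ((hl i s).1.trans hs'.symm))
      simp at this
    have hle := Finset.card_le_card (Finset.union_subset (hMN j) hDN)
    rw [Finset.card_union_of_disjoint hdisj] at hle
    omega
  have htot : ∑ j, (M j).card = ∑ j, b j := by
    rw [← hsum, ← Finset.sum_congr rfl fun i _ => hcol i]
    have := Finset.sum_card_bipartiteAbove_eq_sum_card_bipartiteBelow
      (s := (Finset.univ : Finset α)) (t := (Finset.univ : Finset β)) (fun j i => i ∈ M j)
    simpa [Finset.bipartiteAbove, Finset.bipartiteBelow] using this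
  exact ⟨M, hMN, fun j => (Finset.sum_eq_sum_iff_of_le fun j _ => hrow j).1 htot j
    (Finset.mem_univ j), hcol⟩

theorem sum_le_sum_ite_lt_card_of_antitone {n : ℕ} {w : Fin n → ℕ} (hw : Antitone w)
    (T : Finset (Fin n)) :
    ∑ i ∈ T, w i ≤ ∑ i : Fin n, if (i : ℕ) < T.card then w i else 0 := by
  have hcard : T.card ≤ n := by simpa using T.card_le_univ
  let e := T.orderEmbOfFin rfl
  have hle : ∀ x : Fin T.card, (x : ℕ) ≤ e x := by
    rintro ⟨x, hx⟩
    induction x with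
    | zero => exact Nat.zero_le _
    | succ x ih =>
      have hlt : e ⟨x, by omega⟩ < e ⟨x + 1, hx⟩ := e.strictMono (by simp [Fin.lt_def])
      exact (ih (by omega)).trans_lt hlt
  have hT : ∑ i ∈ T, w i = ∑ x, w (e x) := by
    have := Finset.sum_map Finset.univ e.toEmbedding w
    rwa [Finset.map_orderEmbOfFin_univ] at this
  have hP : ∑ x : Fin T.card, w (Fin.castLE hcard x) =
      ∑ i : Fin n, if (i : ℕ) < T.card then w i else 0 := by
    rw [← Finset.sum_filter]
    refine (Finset.sum_map Finset.univ (Fin.castLEEmb hcard) w).symm.trans ?_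
    congr 1
    ext i
    simp only [Finset.mem_map, Finset.mem_univ, true_and, Finset.mem_filter]
    exact ⟨fun ⟨x, hx⟩ => hx ▸ x.2, fun h => ⟨⟨i, h⟩, rfl⟩⟩
  rw [hT, ← hP]
  exact Finset.sum_le_sum fun x _ => hw (hle x)

theorem Antitone.add_ite_le_of_lex {n : ℕ} {a b : Fin n → ℕ}
    (hlex : ∀ i : Fin n, ∀ hi : (i : ℕ) + 1 < n,
      a ⟨(i : ℕ) + 1, hi⟩ < a i ∨
        (a i = a ⟨(i : ℕ) + 1, hi⟩ ∧ b ⟨(i : ℕ) + 1, hi⟩ ≤ b i)) (k : ℕ) :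
    Antitone fun i => a i + if k ≤ b i then 1 else 0 := by
  cases n with
  | zero => exact fun i => i.elim0
  | succ n =>
    refine Fin.antitone_iff_succ_le.2 fun i => ?_
    have h : a i.succ < a i.castSucc ∨
        (a i.castSucc = a i.succ ∧ b i.succ ≤ b i.castSucc) :=
      hlex i.castSucc (by simp)
    split_ifs <;> omega

/-- The Fulkerson-Chen inequality for an arbitrary set `T` of heads in place of an initial
segment. -/
theorem sum_le_sum_min_card_erase {n : ℕ} (a b : Fin n → ℕ)
    (hlex : ∀ i : Fin n, ∀ hi : (i : ℕ) + 1 < n,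
      a ⟨(i : ℕ) + 1, hi⟩ < a i ∨
        (a i = a ⟨(i : ℕ) + 1, hi⟩ ∧ b ⟨(i : ℕ) + 1, hi⟩ ≤ b i))
    (h : ∀ k : ℕ, 1 ≤ k → k ≤ n →
        (∑ i : Fin n, if (i : ℕ) < k then a i else 0) ≤
          ∑ i : Fin n, (if (i : ℕ) < k then min (b i) (k - 1) else min (b i) k))
    (T : Finset (Fin n)) :
    ∑ i ∈ T, a i ≤ ∑ j, min (b j) (T.erase j).card := by
  rcases T.eq_empty_or_nonempty with rfl | hne
  · simp
  have hpos := hne.card_pos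
  have hk := h T.card hpos (by simpa using T.card_le_univ)
  have hw := sum_le_sum_ite_lt_card_of_antitone (Antitone.add_ite_le_of_lex hlex T.card) T
  have hL : ∑ j, min (b j) (T.erase j).card + ∑ i ∈ T, (if T.card ≤ b i then 1 else 0) =
      ∑ j, min (b j) T.card := by
    have hite : ∑ i ∈ T, (if T.card ≤ b i then 1 else 0) =
        ∑ i, if i ∈ T then (if T.card ≤ b i then 1 else 0) else 0 := by
      rw [Finset.sum_ite_mem, Finset.univ_inter]
    rw [hite, ← Finset.sum_add_distrib]
    refine Finset.sum_congr rfl fun j _ => ?_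
    rw [Finset.card_erase_eq_ite]
    split_ifs <;> omega
  have hR : ∑ i : Fin n, (if (i : ℕ) < T.card then min (b i) (T.card - 1) else min (b i) T.card) +
      ∑ i : Fin n, (if (i : ℕ) < T.card then (if T.card ≤ b i then 1 else 0) else 0) =
      ∑ j, min (b j) T.card := by
    rw [← Finset.sum_add_distrib]
    refine Finset.sum_congr rfl fun j _ => ?_
    split_ifs <;> omega
  have hsplit : (∑ i : Fin n, if (i : ℕ) < T.card then
        a i + (if T.card ≤ b i then 1 else 0) else 0) =
      (∑ i : Fin n, if (i : ℕ) < T.card then a i else 0) +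
      ∑ i : Fin n, (if (i : ℕ) < T.card then (if T.card ≤ b i then 1 else 0) else 0) := by
    rw [← Finset.sum_add_distrib]
    refine Finset.sum_congr rfl fun j _ => ?_
    split_ifs <;> rfl
  rw [hsplit, Finset.sum_add_distrib] at hw
  omega

/-- In a loopless digraph, the total indegree of a set `T` of heads is bounded rowwise. -/
theorem sum_indegree_le_sum_min_card_erase {α : Type*} [Fintype α] [DecidableEq α]
    (G : α → α → Bool) (hG : ∀ i, G i i = false) (T : Finset α) :
    ∑ i ∈ T, (Finset.univ.filter (fun j => G j i = true)).card ≤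
      ∑ j, min (Finset.univ.filter (fun i => G j i = true)).card (T.erase j).card := by
  have := Finset.sum_card_bipartiteAbove_eq_sum_card_bipartiteBelow
    (s := (Finset.univ : Finset α)) (t := T) (fun j i => G j i = true)
  simp only [Finset.bipartiteAbove, Finset.bipartiteBelow] at this
  rw [← this]
  refine Finset.sum_le_sum fun j _ => le_min (Finset.card_le_card ?_) (Finset.card_le_card ?_)
  · exact Finset.filter_subset_filter _ (Finset.subset_univ T)
  · intro i hi
    obtain ⟨hiT, hji⟩ := Finset.mem_filter.1 hi
    refine Finset.mem_erase.2 ⟨?_, hiT⟩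
    rintro rfl
    simp [hG] at hji

/-- Characterization of digraph sequences (Gale, Ryser, Fulkerson, Chen):
a sequence in decreasing lexicographical order with `∑ a i = ∑ b i` is a digraph
sequence iff for all `k ∈ {1,…,n}`,
`∑_{i=1}^{k} min(b i, k-1) + ∑_{i=k+1}^{n} min(b i, k) ≥ ∑_{i=1}^{k} a i`. -/
theorem digraph_seq_iff_fulkerson_chen {n : ℕ} (a b : Fin n → ℕ)
    (hsum : ∑ i, a i = ∑ i, b i)
    (hlex : ∀ i : Fin n, ∀ hi : (i : ℕ) + 1 < n,
      a ⟨(i : ℕ) + 1, hi⟩ < a i ∨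
        (a i = a ⟨(i : ℕ) + 1, hi⟩ ∧ b ⟨(i : ℕ) + 1, hi⟩ ≤ b i)) :
    IsDigraphSeq a b ↔
      ∀ k : ℕ, 1 ≤ k → k ≤ n →
        (∑ i : Fin n, if (i : ℕ) < k then a i else 0) ≤
          ∑ i : Fin n, (if (i : ℕ) < k then min (b i) (k - 1) else min (b i) k) := by
  constructor
  · rintro ⟨G, hG, ha, hb⟩ k hk hkn
    have hcard : (Finset.univ.filter fun i : Fin n => (i : ℕ) < k).card = k := by
      simp [Fin.card_filter_val_lt, hkn]
    have h := sum_indegree_le_sum_min_card_erase G hG (Finset.univ.filter fun i => (i : ℕ) < k)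
    simp only [ha, hb, Finset.card_erase_eq_ite, hcard, Finset.mem_filter, Finset.mem_univ,
      true_and] at h
    rw [Finset.sum_filter] at h
    refine h.trans (Finset.sum_le_sum fun i _ => ?_)
    split_ifs <;> rfl
  · intro h
    obtain ⟨M, hM, hb, ha⟩ := exists_subgraph_of_sum_le_sum_min (fun j => Finset.univ.erase j) a b
      hsum fun T => by
        simpa [Finset.erase_inter] using sum_le_sum_min_card_erase a b hlex h T
    refine ⟨fun j i => decide (i ∈ M j), fun i => ?_, fun i => ?_, fun j => ?_⟩
    · simpa using fun hi => Finset.notMem_erase i _ (hM i hi)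
    · simpa using ha i
    · simpa using hb j
end

section
/- Let G be a directed graph (no loops, no parallel arcs; oppositely directed arcs allowed) on a finite labeled vertex set {v_1,…,v_n} with indegrees a_i and outdegrees b_i. Then for every k ∈ {1,…,n} (i.e. for the vertices in any fixed order, no sorting assumed): ∑_{i=1}^{k} min(b_i, k−1) + ∑_{i=k+1}^{n} min(b_i, k) ≥ ∑_{i=1}^{k} a_i. -/
/-- Necessity of the Fulkerson–Chen inequalities, for an arbitrary vertex ordering:
if `G` is a digraph (no loops, no parallel arcs; opposite arcs allowed), given by its
boolean adjacency matrix, with indegrees `a i` and outdegrees `b i`, then for every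
`k ∈ {1,…,n}`:
`∑_{i=1}^{k} min(b i, k-1) + ∑_{i=k+1}^{n} min(b i, k) ≥ ∑_{i=1}^{k} a i`. -/
theorem fulkerson_chen_necessary {n : ℕ} (G : Fin n → Fin n → Bool)
    (hloopless : ∀ i, G i i = false) (a b : Fin n → ℕ)
    (ha : ∀ i, (Finset.univ.filter (fun j => G j i = true)).card = a i)
    (hb : ∀ i, (Finset.univ.filter (fun j => G i j = true)).card = b i) :
    ∀ k : ℕ, 1 ≤ k → k ≤ n →
      (∑ i : Fin n, if (i : ℕ) < k then a i else 0) ≤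
        ∑ i : Fin n, (if (i : ℕ) < k then min (b i) (k - 1) else min (b i) k) := by
  intro k _ hkn
  set S : Finset (Fin n) := Finset.univ.filter (fun i => (i : ℕ) < k) with hS
  have hScard : S.card = k := by
    rw [hS, Fin.card_filter_val_lt, min_eq_right hkn]
  calc (∑ i : Fin n, if (i : ℕ) < k then a i else 0)
      = ∑ i ∈ S, (Finset.univ.filter (fun j => G j i = true)).card := by
        rw [hS, Finset.sum_filter]
        simp only [ha]
    _ = ∑ j : Fin n, (S.filter (fun i => G j i = true)).card :=
        (Finset.sum_card_bipartiteAbove_eq_sum_card_bipartiteBelow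
          (fun j i => G j i = true)).symm
    _ ≤ _ := by
        refine Finset.sum_le_sum fun j _ => ?_
        have hout : (S.filter (fun i => G j i = true)).card ≤ b j :=
          hb j ▸ Finset.card_le_card (Finset.filter_subset_filter _ S.subset_univ)
        split_ifs with hj
        · refine le_min hout ?_
          have hjS : j ∈ S := by simpa [hS] using hj
          rw [← hScard, ← Finset.card_erase_of_mem hjS]
          refine Finset.card_le_card fun i hi => ?_
          obtain ⟨hiS, hji⟩ := Finset.mem_filter.mp hi
          refine Finset.mem_erase.mpr ⟨?_, hiS⟩
          rintro rfl
          simp [hloopless] at hji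
        · exact le_min hout ((Finset.card_filter_le _ _).trans_eq hScard)
end

section
/- The sequence S = ((3,3),(1,2),(3,3),(3,2)) is not a digraph sequence; that is, there is no directed graph (no loops, no parallel arcs; oppositely directed arcs allowed) on four labeled vertices v_1,…,v_4 whose indegree/outdegree pairs are (3,3), (1,2), (3,3), (3,2) in this order. -/
/-- The paper's counterexample: `S = ((3,3),(1,2),(3,3),(3,2))` is not a digraph
sequence. -/
theorem counterexample_not_digraph_seq :
    ¬ IsDigraphSeq (![3, 1, 3, 3] : Fin 4 → ℕ) (![3, 2, 3, 2] : Fin 4 → ℕ) := by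
  rintro ⟨G, hloop, hin, hout⟩
  have h₀ := hloop 0
  have h₂ := hloop 2
  have hin₁ := hin 1
  have hout₀ := hout 0
  have hout₂ := hout 2
  simp only [Finset.card_filter, Fin.sum_univ_four] at hin₁ hout₀ hout₂
  simp [h₀] at hout₀
  simp [h₂] at hout₂
  simp at hin₁
  split_ifs at hin₁ hout₀ hout₂ <;> omega
end

section
/- Let S = ((a_1,b_1),…,(a_n,b_n)) be a sequence of pairs of nonnegative integers with ∑_{i=1}^n a_i = ∑_{i=1}^n b_i and a_1 ≥ a_2 ≥ … ≥ a_n. Then S is realizable as a directed graph with at most one loop per vertex (and no parallel arcs) if and only if for every k ∈ {1,…,n−1} with a_k > a_{k+1}, and also for k = n, one has ∑_{i=1}^{n} min(b_i, k) ≥ ∑_{i=1}^{k} a_i. -/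
/-- `S = ((a i, b i))_{i}` is realizable as a directed graph with at most one loop per
vertex and no parallel arcs, given by its boolean adjacency matrix `G` (a diagonal entry
`G i i = true` is a loop, contributing one to both indegree and outdegree of `v i`),
in which vertex `v i` has indegree `a i` and outdegree `b i`. -/
def IsLoopDigraphSeq {n : ℕ} (a b : Fin n → ℕ) : Prop :=
  ∃ G : Fin n → Fin n → Bool,
    (∀ i, (Finset.univ.filter (fun j => G j i = true)).card = a i) ∧
    (∀ i, (Finset.univ.filter (fun j => G i j = true)).card = b i)

/-- The sum of the first `k` entries of `f`. -/
def prefixSum {n : ℕ} (f : Fin n → ℕ) (k : ℕ) : ℕ :=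
  ∑ i : Fin n, if (i : ℕ) < k then f i else 0

/-- The number of `true` entries in column `i` of `G`. -/
def colSum {m n : ℕ} (G : Fin m → Fin n → Bool) (i : Fin n) : ℕ :=
  (Finset.univ.filter (fun j => G j i = true)).card

theorem prefixSum_zero {n : ℕ} (f : Fin n → ℕ) : prefixSum f 0 = 0 := by
  simp [prefixSum]

theorem prefixSum_of_le {n : ℕ} (f : Fin n → ℕ) {k : ℕ} (hk : n ≤ k) :
    prefixSum f k = ∑ i, f i :=
  Finset.sum_congr rfl fun i _ => if_pos (i.2.trans_le hk)

theorem prefixSum_succ {n : ℕ} (f : Fin n → ℕ) {k : ℕ} (hk : k < n) :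
    prefixSum f (k + 1) = prefixSum f k + f ⟨k, hk⟩ := by
  have h : f ⟨k, hk⟩ = ∑ i : Fin n, if i = ⟨k, hk⟩ then f i else 0 := by simp
  rw [h, prefixSum, prefixSum, ← Finset.sum_add_distrib]
  refine Finset.sum_congr rfl fun i _ => ?_
  simp only [Fin.ext_iff]
  split_ifs <;> omega

theorem prefixSum_add {n : ℕ} (f g : Fin n → ℕ) (k : ℕ) :
    prefixSum (fun i => f i + g i) k = prefixSum f k + prefixSum g k := by
  simp only [prefixSum, ← Finset.sum_add_distrib]
  exact Finset.sum_congr rfl fun i _ => by split_ifs <;> rfl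

theorem prefixSum_single {n : ℕ} (x : Fin n) (k : ℕ) :
    prefixSum (fun i => if i = x then 1 else 0) k = if (x : ℕ) < k then 1 else 0 := by
  simp only [prefixSum]
  rw [Finset.sum_eq_single x (fun i _ hi => by simp [hi]) (by simp)]
  simp

theorem prefixSum_colSum {m n : ℕ} (G : Fin m → Fin n → Bool) (k : ℕ) :
    prefixSum (colSum G) k =
      ∑ j, (Finset.univ.filter (fun i : Fin n => (i : ℕ) < k ∧ G j i = true)).card := by
  simp only [prefixSum, colSum, Finset.card_filter]
  rw [Finset.sum_comm]
  refine Finset.sum_congr rfl fun i _ => ?_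
  split_ifs with h <;> simp [h]

theorem prefixSum_colSum_le {m n : ℕ} (G : Fin m → Fin n → Bool) (k : ℕ) :
    prefixSum (colSum G) k ≤
      ∑ j, min (Finset.univ.filter (fun i => G j i = true)).card k := by
  rw [prefixSum_colSum]
  refine Finset.sum_le_sum fun j _ => le_min ?_ ?_
  · exact Finset.card_le_card fun i hi => by simp_all
  · calc _ ≤ (Finset.univ.filter (fun i : Fin n => (i : ℕ) < k)).card :=
          Finset.card_le_card fun i hi => by simp_all
      _ ≤ k := by rw [Fin.card_filter_val_lt]; exact min_le_right _ _

/-- A point of `P` between two points outside `P` lies in a maximal run of points of `P`. -/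
theorem exists_maximal_run {P : ℕ → Prop} {n k : ℕ} (h0 : ¬P 0) (hn : ¬P n) (hkn : k ≤ n)
    (hk : P k) : ∃ p q, p + 1 < q ∧ q ≤ n ∧ ¬P p ∧ ¬P q ∧ ∀ j, p < j → j < q → P j := by
  classical
  have hq : ∃ d, ¬P (k + d) := ⟨n - k, by rwa [Nat.add_sub_cancel' hkn]⟩
  have hp : ∃ d, ¬P (k - d) := ⟨k, by rwa [Nat.sub_self]⟩
  have hqm : ∀ d, d < Nat.find hq → P (k + d) := fun d hd => not_not.1 (Nat.find_min hq hd)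
  have hpm : ∀ d, d < Nat.find hp → P (k - d) := fun d hd => not_not.1 (Nat.find_min hp hd)
  have hqs := Nat.find_spec hq
  have hps := Nat.find_spec hp
  have hqn : Nat.find hq ≤ n - k := Nat.find_min' hq (by rwa [Nat.add_sub_cancel' hkn])
  have hpk : Nat.find hp ≤ k := Nat.find_min' hp (by rwa [Nat.sub_self])
  generalize Nat.find hq = d at *
  generalize Nat.find hp = e at *
  have hd : d ≠ 0 := by rintro rfl; exact hqs hk
  have he : e ≠ 0 := by rintro rfl; exact hps hk
  refine ⟨k - e, k + d, by omega, by omega, hps, hqs, fun j hj hj' => ?_⟩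
  rcases le_total k j with h | h
  · have := hqm (j - k) (by omega)
    rwa [Nat.add_sub_cancel' h] at this
  · have := hpm (k - j) (by omega)
    rwa [Nat.sub_sub_self h] at this

/-- Moving one entry of some row from a larger column to a smaller one. -/
theorem exists_shift_entry {m n : ℕ} (G : Fin m → Fin n → Bool) {x y : Fin n}
    (h : colSum G y < colSum G x) :
    ∃ G' : Fin m → Fin n → Bool,
      (∀ j, (Finset.univ.filter (fun i => G' j i = true)).card =
        (Finset.univ.filter (fun i => G j i = true)).card) ∧
      ∀ k, prefixSum (colSum G') k + (if (x : ℕ) < k then 1 else 0) =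
        prefixSum (colSum G) k + (if (y : ℕ) < k then 1 else 0) := by
  obtain ⟨r, hrx, hry⟩ : ∃ r, G r x = true ∧ G r y = false := by
    by_contra! hc
    refine h.not_ge (Finset.card_le_card fun j hj => ?_)
    simp only [Finset.mem_filter, Finset.mem_univ, true_and] at hj ⊢
    simpa using hc j hj
  have hxy : x ≠ y := by rintro rfl; simp [hrx] at hry
  refine ⟨fun j i => if j = r then G j (Equiv.swap x y i) else G j i, fun j => ?_, fun k => ?_⟩
  · by_cases hj : j = r
    · simp only [hj, if_true, Finset.card_filter]
      exact Equiv.sum_comp (Equiv.swap x y) fun i => if G r i = true then 1 else 0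
    · simp [hj]
  · rw [← prefixSum_single x, ← prefixSum_single y, ← prefixSum_add, ← prefixSum_add]
    congr 1
    funext i
    simp only [colSum, Finset.card_filter]
    rw [← Finset.add_sum_erase _ _ (Finset.mem_univ r),
      ← Finset.add_sum_erase (a := r) _ (fun j => if G j i = true then 1 else 0)
        (Finset.mem_univ r)]
    have hrest : ∑ j ∈ Finset.univ.erase r,
        (if (if j = r then G j (Equiv.swap x y i) else G j i) = true then 1 else 0) =
        ∑ j ∈ Finset.univ.erase r, if G j i = true then 1 else 0 :=
      Finset.sum_congr rfl fun j hj => by simp [Finset.ne_of_mem_erase hj]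
    rw [hrest]
    by_cases hix : i = x
    · subst hix
      simp [hrx, hry, hxy]
      omega
    · by_cases hiy : i = y
      · subst hiy
        simp [hrx, hry, hix]
        omega
      · simp [Equiv.swap_apply_of_ne_of_ne hix hiy, hix, hiy]

/-- If the column sums of `G` dominate the antitone sequence `a`, then `G` can be rearranged
within its rows so that the column sums become `a`. -/
theorem exists_colSum_eq_of_prefixSum_le {m n : ℕ} (a : Fin n → ℕ) (ha : Antitone a)
    (G : Fin m → Fin n → Bool) (hle : ∀ k, prefixSum a k ≤ prefixSum (colSum G) k)
    (heq : prefixSum a n = prefixSum (colSum G) n) :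
    ∃ G' : Fin m → Fin n → Bool, colSum G' = a ∧
      ∀ j, (Finset.univ.filter (fun i => G' j i = true)).card =
        (Finset.univ.filter (fun i => G j i = true)).card := by
  induction hM : ∑ k ∈ Finset.range n, prefixSum (colSum G) k using Nat.strong_induction_on
    generalizing G with
  | _ M ih =>
  by_cases hall : ∀ k ≤ n, prefixSum (colSum G) k = prefixSum a k
  · refine ⟨G, funext fun i => ?_, fun _ => rfl⟩
    have h1 := hall (i + 1) i.2
    rw [prefixSum_succ _ i.2, prefixSum_succ _ i.2, hall i i.2.le] at h1
    exact Nat.add_left_cancel h1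
  push Not at hall
  obtain ⟨k, hkn, hk⟩ := hall
  obtain ⟨p, q, hpq, hqn, hp, hq, hmid⟩ :=
    exists_maximal_run (P := fun k => prefixSum a k < prefixSum (colSum G) k)
      (by simp [prefixSum_zero]) heq.not_lt hkn (lt_of_le_of_ne (hle k) hk.symm)
  obtain ⟨q, rfl⟩ : ∃ q', q = q' + 1 := ⟨q - 1, by omega⟩
  have hp1 := hmid (p + 1) (by omega) (by omega)
  have hq1 := hmid q (by omega) (by omega)
  have hpn : p < n := by omega
  have hapq : a ⟨q, hqn⟩ ≤ a ⟨p, hpn⟩ := ha (Fin.mk_le_mk.2 (by omega))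
  have hlep := hle p
  have hleq := hle (q + 1)
  simp only [prefixSum_succ _ hpn] at hp1
  simp only [prefixSum_succ _ hqn] at hq hleq
  obtain ⟨G', hrow, hcol⟩ := exists_shift_entry G (x := ⟨p, hpn⟩) (y := ⟨q, hqn⟩) (by omega)
  simp only at hcol
  have hdec : ∀ k, prefixSum (colSum G') k ≤ prefixSum (colSum G) k := fun k => by
    have := hcol k
    split_ifs at this <;> omega
  obtain ⟨G'', hG'', hrow''⟩ := ih _ (by
      rw [← hM]
      refine Finset.sum_lt_sum (fun k _ => hdec k) ⟨p + 1, by simp; omega, ?_⟩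
      have := hcol (p + 1)
      split_ifs at this <;> omega) G' (fun k => by
        have h1 := hcol k
        have h2 := hle k
        have h3 := hmid k
        split_ifs at h1 with h4 h5 h5
        · omega
        · have := h3 h4 (by omega)
          omega
        · omega
        · omega) (by
        have := hcol n
        rw [if_pos hpn, if_pos (show q < n by omega)] at this
        omega) rfl
  exact ⟨G'', hG'', fun j => (hrow'' j).trans (hrow j)⟩

/-- Dominance of an antitone sequence `c` over `a` need only be checked where `a` drops. -/
theorem prefixSum_le_of_le_at_drops {n : ℕ} {a c : Fin n → ℕ} (hc : Antitone c)
    (hdrop : ∀ k : ℕ, ∀ hk : k < n, 1 ≤ k → a ⟨k, hk⟩ < a ⟨k - 1, by omega⟩ →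
      prefixSum a k ≤ prefixSum c k)
    (htotal : ∑ i, a i ≤ ∑ i, c i) (k : ℕ) : prefixSum a k ≤ prefixSum c k := by
  rcases le_total n k with hnk | hkn
  · rwa [prefixSum_of_le _ hnk, prefixSum_of_le _ hnk]
  by_contra! hlt
  obtain ⟨p, q, hpq, hqn, hp, hq, hmid⟩ :=
    exists_maximal_run (P := fun k => prefixSum c k < prefixSum a k)
      (by simp [prefixSum_zero]) (by simpa [prefixSum_of_le] using htotal) hkn hlt
  obtain ⟨q, rfl⟩ : ∃ q', q = q' + 1 := ⟨q - 1, by omega⟩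
  have hpn : p < n := by omega
  have hconst : ∀ j, p ≤ j → ∀ hj : j < q + 1, a ⟨p, hpn⟩ ≤ a ⟨j, by omega⟩ := by
    intro j hpj
    induction j, hpj using Nat.le_induction with
    | base => exact fun _ => le_rfl
    | succ j hpj ih =>
      intro hj
      refine (ih (by omega)).trans (not_lt.1 fun hd => ?_)
      exact (hmid (j + 1) (by omega) hj).not_ge (hdrop (j + 1) (by omega) (by omega) hd)
  have hp1 := hmid (p + 1) (by omega) (by omega)
  have hq1 := hmid q (by omega) (by omega)
  have hapq := hconst q (by omega) (by omega)
  have hcpq : c ⟨q, hqn⟩ ≤ c ⟨p, hpn⟩ := hc (Fin.mk_le_mk.2 (by omega))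
  simp only [prefixSum_succ _ hpn] at hp1
  simp only [prefixSum_succ _ hqn] at hq
  omega

/-- Theorem 2 of the paper (strengthened Gale–Ryser): for `a₁ ≥ … ≥ aₙ` with
`∑ a i = ∑ b i`, the sequence is realizable as a digraph with at most one loop per
vertex iff `∑_{i=1}^{n} min(b i, k) ≥ ∑_{i=1}^{k} a i` holds for every
`k ∈ {1,…,n-1}` with `a k > a (k+1)` and for `k = n`. -/
theorem loop_digraph_seq_iff_gale_ryser_drops {n : ℕ} (a b : Fin n → ℕ)
    (hsum : ∑ i, a i = ∑ i, b i)
    (hdec : ∀ i j : Fin n, i ≤ j → a j ≤ a i) :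
    IsLoopDigraphSeq a b ↔
      ((∀ k : ℕ, ∀ hk : k < n, 1 ≤ k → a ⟨k, hk⟩ < a ⟨k - 1, by omega⟩ →
          (∑ i : Fin n, if (i : ℕ) < k then a i else 0) ≤ ∑ i : Fin n, min (b i) k) ∧
        (∑ i : Fin n, a i) ≤ ∑ i : Fin n, min (b i) n) := by
  have hanti : Antitone a := fun i j h => hdec i j h
  constructor
  · rintro ⟨G, hin, hout⟩
    have hcol : colSum G = a := funext hin
    have hle : ∀ k, prefixSum a k ≤ ∑ i, min (b i) k := fun k => by
      simpa only [hcol, hout] using prefixSum_colSum_le G k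
    exact ⟨fun k _ _ _ => hle k, by simpa only [prefixSum_of_le a le_rfl] using hle n⟩
  · rintro ⟨hdrop, htotal⟩
    have hbn : ∀ i, min (b i) n = b i := fun i =>
      (Finset.sum_eq_sum_iff_of_le fun i _ => min_le_left (b i) n).1
        (le_antisymm (Finset.sum_le_sum fun i _ => min_le_left _ _) (hsum ▸ htotal)) i
        (Finset.mem_univ i)
    let F : Fin n → Fin n → Bool := fun j i => decide ((i : ℕ) < b j)
    have hF : ∀ k ≤ n, prefixSum (colSum F) k = ∑ j, min (b j) k := fun k hk => by
      rw [prefixSum_colSum]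
      refine Finset.sum_congr rfl fun j _ => ?_
      have hset : Finset.univ.filter (fun i : Fin n => (i : ℕ) < k ∧ F j i = true) =
          Finset.univ.filter (fun i : Fin n => (i : ℕ) < min (b j) k) := by
        ext i
        simp [F, and_comm]
      rw [hset, Fin.card_filter_val_lt]
      omega
    have hFn : prefixSum (colSum F) n = ∑ i, a i := by
      rw [hF n le_rfl, hsum]
      exact Finset.sum_congr rfl fun i _ => hbn i
    have hFanti : Antitone (colSum F) := fun i j hij =>
      Finset.card_le_card fun r hr => by
        simp only [F, Finset.mem_filter, Finset.mem_univ, true_and, decide_eq_true_eq] at hr ⊢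
        exact (Fin.le_def.1 hij).trans_lt hr
    obtain ⟨G, hcol, hrow⟩ := exists_colSum_eq_of_prefixSum_le a hanti F
      (prefixSum_le_of_le_at_drops hFanti
        (fun k hk h1 hd => (hdrop k hk h1 hd).trans_eq (hF k hk.le).symm)
        (by rw [← hFn, prefixSum_of_le _ le_rfl]))
      (by rw [hFn, prefixSum_of_le _ le_rfl])
    refine ⟨G, fun i => congrFun hcol i, fun j => (hrow j).trans ?_⟩
    simp only [F, decide_eq_true_eq]
    rw [Fin.card_filter_val_lt, min_comm, hbn]
end

section
/- Let b_1,…,b_n be nonnegative integers, let σ be a permutation of {1,…,n}, and define X_σ(k) := ∑_{i=1}^{k} min(b_{σ(i)}, k−1) + ∑_{i=k+1}^{n} min(b_{σ(i)}, k) for k ∈ {1,…,n}, with X_σ(0) := 0. Then for all k, k' ∈ {1,…,n} with k' > k: X_σ(k') − X_σ(k'−1) ≤ X_σ(k) − X_σ(k−1) + 1. -/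
/-- `X_σ(k) = ∑_{i=1}^{k} min(b_{σ(i)}, k-1) + ∑_{i=k+1}^{n} min(b_{σ(i)}, k)`,
the left-hand side of the Fulkerson–Chen inequality for the reordered sequence
(note `Xperm b σ 0 = 0` automatically). -/
def Xperm {n : ℕ} (b : Fin n → ℕ) (σ : Equiv.Perm (Fin n)) (k : ℕ) : ℕ :=
  ∑ i : Fin n, if (i : ℕ) < k then min (b (σ i)) (k - 1) else min (b (σ i)) k

/-- First claim of Proposition 2 of the paper: for `k, k' ∈ {1,…,n}` with `k' > k`,
`X_σ(k') - X_σ(k'-1) ≤ X_σ(k) - X_σ(k-1) + 1`. -/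
theorem Xperm_diff_le_diff_add_one {n : ℕ} (b : Fin n → ℕ) (σ : Equiv.Perm (Fin n))
    (k k' : ℕ) (hk : 1 ≤ k) (hk' : k' ≤ n) (hkk' : k < k') :
    (Xperm b σ k' : ℤ) - (Xperm b σ (k' - 1) : ℤ) ≤
      (Xperm b σ k : ℤ) - (Xperm b σ (k - 1) : ℤ) + 1 := by
  have key : Xperm b σ k' + Xperm b σ (k - 1) ≤
      Xperm b σ k + Xperm b σ (k' - 1) +
        ∑ i : Fin n, (if i = ⟨k - 1, by omega⟩ then 1 else 0) := by
    simp only [Xperm, ← Finset.sum_add_distrib, Fin.ext_iff]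
    refine Finset.sum_le_sum fun i _ => ?_
    split_ifs <;> omega
  rw [Finset.sum_ite_eq' Finset.univ, if_pos (Finset.mem_univ _)] at key
  omega
end

section
/- Let b_1,…,b_n be nonnegative integers, let σ be a permutation of {1,…,n}, and define X_σ(k) := ∑_{i=1}^{k} min(b_{σ(i)}, k−1) + ∑_{i=k+1}^{n} min(b_{σ(i)}, k) for k ∈ {1,…,n}, with X_σ(0) := 0. If for some k ≥ 2 one has X_σ(k) − X_σ(k−1) = X_σ(k−1) − X_σ(k−2) + 1, then for every k' ∈ {k+1,…,n}: X_σ(k') − X_σ(k'−1) ≤ X_σ(k) − X_σ(k−1). -/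
/-- The integer-valued summand of `Xperm` at an index `i` carrying the value `c`. -/
def xpermTerm (c i k : ℕ) : ℤ :=
  if i < k then min (c : ℤ) ((k - 1 : ℕ) : ℤ) else min (c : ℤ) k

theorem cast_Xperm {n : ℕ} (b : Fin n → ℕ) (σ : Equiv.Perm (Fin n)) (k : ℕ) :
    (Xperm b σ k : ℤ) = ∑ i : Fin n, xpermTerm (b (σ i)) i k := by
  simp only [Xperm, xpermTerm, Nat.cast_sum, Nat.cast_ite, Nat.cast_min]

/-- A jump of the differences at `k` forces the `k`-th entry to be less than `k - 1`. -/
theorem lt_of_Xperm_jump {n : ℕ} (b : Fin n → ℕ) (σ : Equiv.Perm (Fin n))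
    (k : ℕ) (hk2 : 2 ≤ k) (hkn : k ≤ n)
    (hjump : (Xperm b σ k : ℤ) - (Xperm b σ (k - 1) : ℤ) =
      (Xperm b σ (k - 1) : ℤ) - (Xperm b σ (k - 2) : ℤ) + 1) :
    b (σ ⟨k - 1, by omega⟩) < k - 1 := by
  by_contra! hle
  let p : Fin n := ⟨k - 2, by omega⟩
  let q : Fin n := ⟨k - 1, by omega⟩
  have hterm : ∀ i : Fin n,
      (xpermTerm (b (σ i)) i k - xpermTerm (b (σ i)) i (k - 1)) -
        (xpermTerm (b (σ i)) i (k - 1) - xpermTerm (b (σ i)) i (k - 2)) ≤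
      (if i = p then 1 else 0) - (if i = q then 1 else 0) := by
    intro i
    have hq : (i : ℕ) = k - 1 → k - 1 ≤ b (σ i) := by
      intro hi
      have : i = ⟨k - 1, by omega⟩ := Fin.ext hi
      rwa [this]
    simp only [xpermTerm, Fin.ext_iff, p, q]
    generalize b (σ i) = c at hq ⊢
    split_ifs <;> omega
  have hsum := Finset.sum_le_sum fun i (_ : i ∈ Finset.univ) => hterm i
  simp only [Finset.sum_sub_distrib, ← cast_Xperm, Finset.sum_ite_eq', Finset.mem_univ,
    if_true] at hsum
  omega

/-- Second claim of Proposition 2 of the paper: if for some `k ≥ 2` one has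
`X_σ(k) - X_σ(k-1) = X_σ(k-1) - X_σ(k-2) + 1`, then every later difference satisfies
`X_σ(k') - X_σ(k'-1) ≤ X_σ(k) - X_σ(k-1)` for `k' ∈ {k+1,…,n}`. -/
theorem Xperm_diff_le_diff_of_jump {n : ℕ} (b : Fin n → ℕ) (σ : Equiv.Perm (Fin n))
    (k : ℕ) (hk2 : 2 ≤ k) (hkn : k ≤ n)
    (hjump : (Xperm b σ k : ℤ) - (Xperm b σ (k - 1) : ℤ) =
      (Xperm b σ (k - 1) : ℤ) - (Xperm b σ (k - 2) : ℤ) + 1) :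
    ∀ k' : ℕ, k < k' → k' ≤ n →
      (Xperm b σ k' : ℤ) - (Xperm b σ (k' - 1) : ℤ) ≤
        (Xperm b σ k : ℤ) - (Xperm b σ (k - 1) : ℤ) := by
  intro k' hk' _
  have hlt := lt_of_Xperm_jump b σ k hk2 hkn hjump
  simp only [cast_Xperm, ← Finset.sum_sub_distrib]
  refine Finset.sum_le_sum fun i _ => ?_
  have hq : (i : ℕ) = k - 1 → b (σ i) < k - 1 := by
    intro hi
    have : i = ⟨k - 1, by omega⟩ := Fin.ext hi
    rwa [this]
  simp only [xpermTerm]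
  generalize b (σ i) = c at hq ⊢
  split_ifs <;> omega
end

section
/- Let S = ((a_1,b_1),…,(a_n,b_n)) be a sequence of pairs of nonnegative integers with ∑_{i=1}^n a_i = ∑_{i=1}^n b_i and a_1 ≥ a_2 ≥ … ≥ a_n. Then S is a digraph sequence if and only if for every k ∈ {1,…,n−1} with a_k > a_{k+1}, and also for k = n, one has ∑_{i=1}^{k} min(b_i, k−1) + ∑_{i=k+1}^{n} min(b_i, k) ≥ ∑_{i=1}^{k} a_i. -/
section SetCondition

open Finset

variable {V : Type*} [Fintype V] [DecidableEq V]

/-- The largest number of arcs that can enter `I` when vertex `j` has outdegree `b j`. -/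
def arcCapacity (b : V → ℕ) (I : Finset V) : ℕ :=
  ∑ j, min (b j) (#(I.erase j))

/-- Vertices, other than `x`, that can send a further arc to `x` once they send as many as
possible into `I`. -/
def spareSources (b : V → ℕ) (I : Finset V) (x : V) : Finset V :=
  {j | j ≠ x ∧ #(I.erase j) < b j}

theorem arcCapacity_insert (b : V → ℕ) {I : Finset V} {x : V} (hx : x ∉ I) :
    arcCapacity b (insert x I) = arcCapacity b I + #(spareSources b I x) := by
  rw [arcCapacity, arcCapacity, spareSources, card_filter, ← sum_add_distrib]
  refine sum_congr rfl fun j _ => ?_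
  by_cases hj : j = x
  · subst hj
    simp [erase_insert hx, erase_eq_of_notMem hx]
  · rw [erase_insert_of_ne (Ne.symm hj), card_insert_of_notMem (by simp [hx])]
    simp only [ne_eq, hj, not_false_eq_true, true_and]
    split_ifs <;> omega

theorem spareSources_anti (b : V → ℕ) {I J : Finset V} (h : I ⊆ J) (x : V) :
    spareSources b J x ⊆ spareSources b I x := by
  intro j
  simp only [spareSources, mem_filter, mem_univ, true_and]
  exact fun hj => ⟨hj.1, (card_le_card (erase_subset_erase j h)).trans_lt hj.2⟩

theorem arcCapacity_union_le (a b : V → ℕ) {I : Finset V} (X : Finset V)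
    (hX : ∀ x ∈ X, x ∉ I → #(spareSources b I x) ≤ a x) :
    arcCapacity b (I ∪ X) + ∑ i ∈ I, a i ≤ arcCapacity b I + ∑ i ∈ I ∪ X, a i := by
  induction X using Finset.induction_on with
  | empty => simp
  | insert x X _ ih =>
    have ih := ih fun z hz => hX z (mem_insert_of_mem hz)
    rw [union_insert]
    by_cases hxI : x ∈ I ∪ X
    · rwa [insert_eq_of_mem hxI]
    · have h := hX x (mem_insert_self x X) fun h => hxI (mem_union_left _ h)
      have h' := card_le_card (spareSources_anti b (subset_union_left : I ⊆ I ∪ X) x)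
      rw [arcCapacity_insert b hxI, sum_insert hxI]
      omega

/-- The capacity condition on the superlevel sets of `a` implies it on all sets. -/
theorem sum_le_arcCapacity_of_superlevel (a b : V → ℕ)
    (h : ∀ y, ∑ i with a y ≤ a i, a i ≤ arcCapacity b {i | a y ≤ a i}) (I : Finset V) :
    ∑ i ∈ I, a i ≤ arcCapacity b I := by
  by_contra hI
  let f : Finset V → ℤ := fun J => arcCapacity b J - ∑ i ∈ J, (a i : ℤ)
  obtain ⟨m₀, -, hm₀⟩ := exists_min_image (univ : Finset (Finset V)) f univ_nonempty
  obtain ⟨m, hm, hmin⟩ := exists_min_image ({J | f J ≤ f m₀} : Finset (Finset V)) card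
    ⟨m₀, by simp⟩
  simp only [mem_filter, mem_univ, true_and] at hm hmin hm₀
  have hneg : f m < 0 := by
    have h1 := hm₀ I trivial
    have h2 : f I < 0 := by
      simp only [f]
      push Not at hI
      zify at hI
      omega
    omega
  have hne : m.Nonempty := by
    rw [nonempty_iff_ne_empty]
    rintro rfl
    simp [f] at hneg
    omega
  obtain ⟨y, hy, hymin⟩ := exists_min_image m a hne
  have hdrop : #(spareSources b (m.erase y) y) < a y := by
    by_contra hcon
    have h1 := arcCapacity_insert b (notMem_erase y m)
    rw [insert_erase hy] at h1
    have h2 := add_sum_erase m (fun i => (a i : ℤ)) hy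
    have h3 := hmin (m.erase y) (by simp only [f] at hm ⊢; omega)
    have h4 := card_erase_lt_of_mem hy
    omega
  have hadd : ∀ x ∈ ({i | a y ≤ a i} : Finset V), x ∉ m → #(spareSources b m x) ≤ a x := by
    intro x hx hxm
    simp only [mem_filter, mem_univ, true_and] at hx
    have hsub : spareSources b m x ⊆ insert y (spareSources b (m.erase y) y) := by
      intro j hj
      by_cases hjy : j = y
      · simp [hjy]
      · have := spareSources_anti b (erase_subset y m) x hj
        simp only [spareSources, mem_filter, mem_univ, true_and, mem_insert] at this ⊢
        exact Or.inr ⟨hjy, this.2⟩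
    have h1 := (card_le_card hsub).trans (card_insert_le _ _)
    omega
  have hunion := arcCapacity_union_le a b _ hadd
  have hsubset : m ⊆ ({i | a y ≤ a i} : Finset V) := fun i hi => by simpa using hymin i hi
  rw [union_eq_right.2 hsubset] at hunion
  have := h y
  simp only [f] at hneg
  zify at hunion this
  omega

theorem sum_indegree_le_arcCapacity (G : V → V → Bool) (hG : ∀ i, G i i = false)
    (I : Finset V) :
    ∑ i ∈ I, #{j | G j i = true} ≤ arcCapacity (fun j => #{i | G j i = true}) I := by
  simp only [card_filter]
  rw [sum_comm]
  refine sum_le_sum fun j _ => ?_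
  simp only [← card_filter]
  refine le_min (card_le_card (filter_subset_filter _ (subset_univ I))) (card_le_card ?_)
  intro i hi
  rw [mem_filter] at hi
  refine mem_erase.2 ⟨?_, hi.1⟩
  rintro rfl
  simp [hG] at hi

theorem card_arcs_meeting (I J : Finset V) :
    #{p : V × V | p.1 ≠ p.2 ∧ (p.2 ∈ I ∨ p.1 ∈ J)} =
      ∑ j, if j ∈ J then Fintype.card V - 1 else #(I.erase j) := by
  rw [card_filter, ← univ_product_univ, sum_product]
  refine sum_congr rfl fun j _ => ?_
  rw [← card_filter]
  split_ifs with hj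
  · simp only [hj, or_true, and_true]
    rw [filter_ne, card_erase_of_mem (mem_univ j), card_univ]
  · congr 1
    ext i
    simp [hj, eq_comm]

/-- Hall's theorem applied to in-slots and unused out-slots competing for arcs. -/
theorem exists_slot_assignment (a b : V → ℕ) (hb : ∀ j, b j ≤ Fintype.card V - 1)
    (h : ∀ I : Finset V, ∑ i ∈ I, a i ≤ arcCapacity b I) :
    ∃ f : (Σ i, Fin (a i)) ⊕ (Σ j, Fin (Fintype.card V - 1 - b j)) → V × V,
      Function.Injective f ∧ (∀ x, (f x).1 ≠ (f x).2) ∧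
        (∀ x, (f (Sum.inl x)).2 = x.1) ∧ ∀ x, (f (Sum.inr x)).1 = x.1 := by
  let t : (Σ i, Fin (a i)) ⊕ (Σ j, Fin (Fintype.card V - 1 - b j)) → Finset (V × V) :=
    Sum.elim (fun x => univ.filter fun p => p.1 ≠ p.2 ∧ p.2 = x.1)
      (fun x => univ.filter fun p => p.1 ≠ p.2 ∧ p.1 = x.1)
  have hall : ∀ s, #s ≤ #(s.biUnion t) := by
    intro s
    let I : Finset V := s.toLeft.image Sigma.fst
    let J : Finset V := s.toRight.image Sigma.fst
    have hunion : s.biUnion t =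
        univ.filter fun p : V × V => p.1 ≠ p.2 ∧ (p.2 ∈ I ∨ p.1 ∈ J) := by
      ext p
      simp only [t, I, J, mem_biUnion, Sum.exists, Sum.elim_inl, Sum.elim_inr, mem_filter,
        mem_univ, true_and, mem_image, mem_toLeft, mem_toRight]
      grind
    have hleft : #s.toLeft ≤ ∑ i ∈ I, a i := by
      have : s.toLeft ⊆ I.sigma fun _ => univ := fun x hx => by
        exact mem_sigma.2 ⟨mem_image_of_mem _ hx, mem_univ _⟩
      simpa using card_le_card this
    have hright : #s.toRight ≤ ∑ j ∈ J, (Fintype.card V - 1 - b j) := by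
      have : s.toRight ⊆ J.sigma fun _ => univ := fun x hx => by
        exact mem_sigma.2 ⟨mem_image_of_mem _ hx, mem_univ _⟩
      simpa using card_le_card this
    rw [hunion, card_arcs_meeting, ← card_toLeft_add_card_toRight]
    calc #s.toLeft + #s.toRight
        ≤ arcCapacity b I + ∑ j ∈ J, (Fintype.card V - 1 - b j) :=
          add_le_add (hleft.trans (h I)) hright
      _ = ∑ j, (min (b j) (#(I.erase j)) +
            if j ∈ J then Fintype.card V - 1 - b j else 0) := by
          rw [sum_add_distrib, arcCapacity, sum_ite_mem, univ_inter]
      _ ≤ _ := by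
          refine sum_le_sum fun j _ => ?_
          have := hb j
          split_ifs <;> omega
  obtain ⟨f, hf, hft⟩ := (all_card_le_biUnion_card_iff_exists_injective t).1 hall
  refine ⟨f, hf, fun x => ?_, fun x => ?_, fun x => ?_⟩
  · rcases x with x | x
    · have := hft (Sum.inl x)
      simp only [t, Sum.elim_inl, mem_filter] at this
      exact this.2.1
    · have := hft (Sum.inr x)
      simp only [t, Sum.elim_inr, mem_filter] at this
      exact this.2.1
  · have := hft (Sum.inl x)
    simp only [t, Sum.elim_inl, mem_filter] at this
    exact this.2.2
  · have := hft (Sum.inr x)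
    simp only [t, Sum.elim_inr, mem_filter] at this
    exact this.2.2

theorem exists_digraph_of_sum_le_arcCapacity (a b : V → ℕ) (hsum : ∑ i, a i = ∑ i, b i)
    (h : ∀ I : Finset V, ∑ i ∈ I, a i ≤ arcCapacity b I) :
    ∃ G : V → V → Bool, (∀ i, G i i = false) ∧
      (∀ i, #{j | G j i = true} = a i) ∧ ∀ i, #{j | G i j = true} = b i := by
  have hb : ∀ j, b j ≤ Fintype.card V - 1 := by
    have hu := h univ
    simp only [arcCapacity, card_erase_of_mem (mem_univ _), card_univ, hsum] at hu
    have heq := (sum_eq_sum_iff_of_le fun j _ => min_le_left (b j) (Fintype.card V - 1)).1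
      (le_antisymm (sum_le_sum fun j _ => min_le_left _ _) hu)
    intro j
    have := heq j (mem_univ j)
    omega
  obtain ⟨f, hf, hne, hin, hout⟩ := exists_slot_assignment a b hb h
  let G : V → V → Bool := fun j i => decide (∃ s, f (Sum.inl ⟨i, s⟩) = (j, i))
  have hcol : ∀ i, #{j | G j i = true} = a i := by
    intro i
    have himage : ({j | G j i = true} : Finset V) =
        univ.image fun s : Fin (a i) => (f (Sum.inl ⟨i, s⟩)).1 := by
      ext j
      simp only [G, mem_filter, mem_univ, true_and, mem_image, decide_eq_true_eq]
      exact exists_congr fun s =>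
        ⟨fun hs => by rw [hs], fun hs => Prod.ext hs (hin ⟨i, s⟩)⟩
    rw [himage, card_image_of_injective, card_univ, Fintype.card_fin]
    intro s s' hs
    have := hf (Prod.ext hs ((hin ⟨i, s⟩).trans (hin ⟨i, s'⟩).symm))
    simpa using this
  have hloop : ∀ i, G i i = false := by
    intro i
    simp only [G, decide_eq_false_iff_not, not_exists]
    intro s hs
    exact hne (Sum.inl ⟨i, s⟩) (by rw [hs])
  have hrow : ∀ j, #{i | G j i = true} ≤ b j := by
    intro j
    let U : Finset V := univ.image fun r => (f (Sum.inr ⟨j, r⟩)).2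
    have hU : #U = Fintype.card V - 1 - b j := by
      rw [card_image_of_injective, card_univ, Fintype.card_fin]
      intro r r' hr
      have := hf (Prod.ext ((hout ⟨j, r⟩).trans (hout ⟨j, r'⟩).symm) hr)
      simpa using this
    have hdisj : Disjoint ({i | G j i = true} : Finset V) U := by
      rw [disjoint_left]
      intro i hi hiU
      simp only [G, U, mem_filter, mem_univ, true_and, mem_image, decide_eq_true_eq] at hi hiU
      obtain ⟨s, hs⟩ := hi
      obtain ⟨r, hr⟩ := hiU
      have := hf (hs.trans (Prod.ext (hout ⟨j, r⟩).symm hr.symm))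
      simp at this
    have hsub : ({i | G j i = true} : Finset V) ∪ U ⊆ univ.erase j := by
      intro i hi
      refine mem_erase.2 ⟨?_, mem_univ i⟩
      rintro rfl
      rcases mem_union.1 hi with hi | hi
      · simp [hloop] at hi
      · obtain ⟨r, -, hr⟩ := mem_image.1 hi
        exact hne (Sum.inr ⟨i, r⟩) ((hout ⟨i, r⟩).trans hr.symm)
    have hcard := card_le_card hsub
    rw [card_union_of_disjoint hdisj, hU, card_erase_of_mem (mem_univ j), card_univ] at hcard
    have := hb j
    omega
  have htotal : ∑ j, #{i | G j i = true} = ∑ j, b j := by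
    rw [← hsum, ← sum_congr rfl fun i _ => hcol i]
    simp only [card_filter]
    exact sum_comm
  refine ⟨G, hloop, hcol, fun j => ?_⟩
  exact (sum_eq_sum_iff_of_le fun j _ => hrow j).1 htotal j (mem_univ j)

end SetCondition

theorem isDigraphSeq_iff_forall_sum_le_arcCapacity {n : ℕ} (a b : Fin n → ℕ)
    (hsum : ∑ i, a i = ∑ i, b i) :
    IsDigraphSeq a b ↔ ∀ I : Finset (Fin n), ∑ i ∈ I, a i ≤ arcCapacity b I := by
  refine ⟨?_, exists_digraph_of_sum_le_arcCapacity a b hsum⟩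
  rintro ⟨G, hloop, hin, hout⟩ I
  have h := sum_indegree_le_arcCapacity G hloop I
  simpa only [hin, hout] using h

theorem arcCapacity_initialSegment {n : ℕ} (b : Fin n → ℕ) {k : ℕ} (hk : k ≤ n) :
    arcCapacity b {i | (i : ℕ) < k} =
      ∑ i : Fin n, if (i : ℕ) < k then min (b i) (k - 1) else min (b i) k := by
  have hcard : (Finset.univ.filter fun i : Fin n => (i : ℕ) < k).card = k := by
    rw [Fin.card_filter_val_lt, min_eq_right hk]
  refine Finset.sum_congr rfl fun i _ => ?_
  rw [Finset.card_erase_eq_ite, hcard]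
  simp only [Finset.mem_filter, Finset.mem_univ, true_and]
  split_ifs <;> rfl

/-- A superlevel set of a decreasing sequence is everything, or ends at a strict drop. -/
theorem superlevel_eq_initialSegment {n : ℕ} (a : Fin n → ℕ)
    (hdec : ∀ i j : Fin n, i ≤ j → a j ≤ a i) (y : Fin n) :
    (∀ i, a y ≤ a i) ∨ ∃ k, ∃ hk : k < n, 1 ≤ k ∧ a ⟨k, hk⟩ < a ⟨k - 1, by omega⟩ ∧
      ∀ i : Fin n, a y ≤ a i ↔ (i : ℕ) < k := by
  by_cases hall : ∀ i, a y ≤ a i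
  · exact Or.inl hall
  · right
    push Not at hall
    have hex : ∃ k, ∃ hk : k < n, a ⟨k, hk⟩ < a y := by
      obtain ⟨i, hi⟩ := hall
      exact ⟨i, i.2, hi⟩
    classical
    obtain ⟨hk, hlt⟩ := Nat.find_spec hex
    have hiff : ∀ i : Fin n, a y ≤ a i ↔ (i : ℕ) < Nat.find hex := by
      intro i
      constructor
      · intro hi
        by_contra hcon
        have := hdec ⟨Nat.find hex, hk⟩ i (by simpa [Fin.le_def] using hcon)
        omega
      · intro hi
        by_contra hcon
        exact Nat.find_min hex hi ⟨i.2, by simpa using hcon⟩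
    have hpos := (hiff y).1 le_rfl
    refine ⟨Nat.find hex, hk, by omega, hlt.trans_le ?_, hiff⟩
    exact (hiff ⟨Nat.find hex - 1, by omega⟩).2 (by simp only; omega)

/-- Main theorem of the paper (Digraph Characterization): for `a₁ ≥ … ≥ aₙ` with
`∑ a i = ∑ b i`, the sequence is a digraph sequence iff the Fulkerson–Chen inequality
`∑_{i=1}^{k} min(b i, k-1) + ∑_{i=k+1}^{n} min(b i, k) ≥ ∑_{i=1}^{k} a i`
holds for every `k ∈ {1,…,n-1}` with `a k > a (k+1)` and for `k = n`. -/
theorem digraph_seq_iff_fulkerson_chen_drops {n : ℕ} (a b : Fin n → ℕ)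
    (hsum : ∑ i, a i = ∑ i, b i)
    (hdec : ∀ i j : Fin n, i ≤ j → a j ≤ a i) :
    IsDigraphSeq a b ↔
      ((∀ k : ℕ, ∀ hk : k < n, 1 ≤ k → a ⟨k, hk⟩ < a ⟨k - 1, by omega⟩ →
          (∑ i : Fin n, if (i : ℕ) < k then a i else 0) ≤
            ∑ i : Fin n, (if (i : ℕ) < k then min (b i) (k - 1) else min (b i) k)) ∧
        (∑ i : Fin n, a i) ≤ ∑ i : Fin n, min (b i) (n - 1)) := by
  rw [isDigraphSeq_iff_forall_sum_le_arcCapacity a b hsum]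
  have hinit : ∀ k, k ≤ n →
      (∑ i ∈ Finset.univ.filter fun i : Fin n => (i : ℕ) < k, a i ≤
        arcCapacity b {i : Fin n | (i : ℕ) < k} ↔
        (∑ i : Fin n, if (i : ℕ) < k then a i else 0) ≤
          ∑ i : Fin n, (if (i : ℕ) < k then min (b i) (k - 1) else min (b i) k)) := by
    intro k hk
    rw [arcCapacity_initialSegment b hk, Finset.sum_filter]
  have huniv : arcCapacity b Finset.univ = ∑ i : Fin n, min (b i) (n - 1) := by
    simp [arcCapacity]
  constructor
  · intro h
    exact ⟨fun k hk _ _ => (hinit k hk.le).1 (h _), huniv ▸ h Finset.univ⟩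
  · rintro ⟨hdrop, htotal⟩
    refine sum_le_arcCapacity_of_superlevel a b fun y => ?_
    rcases superlevel_eq_initialSegment a hdec y with hall | ⟨k, hk, hk1, hlt, hiff⟩
    · simpa only [hall, Finset.filter_true, huniv] using htotal
    · simpa only [hiff] using (hinit k hk.le).2 (hdrop k hk hk1 hlt)
end

section
/- Let S = ((a_1,b_1),…,(a_n,b_n)) be a sequence of pairs of nonnegative integers with ∑_{i=1}^n a_i = ∑_{i=1}^n b_i, such that a_1 = a_2 = … = a_n (the indegree component is regular) and b_i ≤ n−1 for all i. Then S is a digraph sequence. -/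
section OutNeighbors

variable {V : Type*} [Fintype V] [DecidableEq V]

/-- The set of in-neighbours of `v` in the digraph whose out-neighbourhoods are given by `N`. -/
def inNeighbors (N : V → Finset V) (v : V) : Finset V :=
  Finset.univ.filter (fun w => v ∈ N w)

/-- Counting the arcs of a digraph by their heads and by their tails. -/
theorem sum_card_inNeighbors (N : V → Finset V) :
    ∑ v, (inNeighbors N v).card = ∑ w, (N w).card := by
  simpa [inNeighbors, Finset.bipartiteAbove, Finset.bipartiteBelow] using
    (Finset.sum_card_bipartiteAbove_eq_sum_card_bipartiteBelow (s := Finset.univ)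
      (t := Finset.univ) (fun v w : V => v ∈ N w))

/-- If the indegree of `u` exceeds that of `v` by at least two, then some in-neighbour of `u`
other than `v` has no arc to `v`. -/
theorem exists_mem_inNeighbors_notMem {N : V → Finset V} {u v : V}
    (h : (inNeighbors N v).card + 1 < (inNeighbors N u).card) :
    ∃ w, w ≠ v ∧ u ∈ N w ∧ v ∉ N w := by
  have hlt : (insert v (inNeighbors N v)).card < (inNeighbors N u).card :=
    (Finset.card_insert_le _ _).trans_lt h
  obtain ⟨w, hwu, hwv⟩ := Finset.exists_mem_notMem_of_card_lt_card hlt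
  simp only [inNeighbors, Finset.mem_insert, Finset.mem_filter, Finset.mem_univ, true_and,
    not_or] at hwu hwv
  exact ⟨w, hwv.1, hwu, hwv.2⟩

/-- Redirecting an arc from a vertex of indegree above `a` to one of indegree below `a` yields
a loopless digraph with the same outdegrees and a smaller total excess of indegrees over `a`. -/
theorem exists_sum_excess_lt {N : V → Finset V} (hN : ∀ w, w ∉ N w) {a : ℕ} {u v : V}
    (hu : a < (inNeighbors N u).card) (hv : (inNeighbors N v).card < a) :
    ∃ N' : V → Finset V, (∀ w, w ∉ N' w) ∧ (∀ w, (N' w).card = (N w).card) ∧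
      ∑ x, ((inNeighbors N' x).card - a) < ∑ x, ((inNeighbors N x).card - a) := by
  obtain ⟨w, hwv, hwu, hwv'⟩ :=
    exists_mem_inNeighbors_notMem (N := N) (u := u) (v := v) (by omega)
  have huv : u ≠ v := by rintro rfl; exact hwv' hwu
  set N' := Function.update N w (insert v ((N w).erase u)) with hN'
  have hmem (x z : V) : x ∈ N' z ↔ if z = w then x = v ∨ x ≠ u ∧ x ∈ N w else x ∈ N z := by
    by_cases hz : z = w
    · subst hz; simp [hN']
    · simp [hN', hz]
  have hsub {x : V} (hx : x ≠ v) : inNeighbors N' x ⊆ inNeighbors N x := by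
    intro z
    simp only [inNeighbors, Finset.mem_filter, Finset.mem_univ, true_and, hmem]
    split_ifs with hz
    · subst hz; tauto
    · exact id
  have hv_le : (inNeighbors N' v).card ≤ a := by
    have : inNeighbors N' v ⊆ insert w (inNeighbors N v) := by
      intro z
      simp only [inNeighbors, Finset.mem_filter, Finset.mem_univ, true_and, hmem,
        Finset.mem_insert]
      split_ifs <;> tauto
    exact (Finset.card_le_card this).trans ((Finset.card_insert_le _ _).trans hv)
  have hu_lt : (inNeighbors N' u).card < (inNeighbors N u).card := by
    refine Finset.card_lt_card (Finset.ssubset_iff_subset_ne.2 ⟨hsub huv, fun h => ?_⟩)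
    have : w ∈ inNeighbors N' u := h ▸ by simpa [inNeighbors] using hwu
    simp [inNeighbors, hmem, huv] at this
  refine ⟨N', fun z hz => ?_, fun z => ?_, ?_⟩
  · rw [hmem] at hz
    split_ifs at hz with h
    · subst h
      exact hz.elim hwv fun h => hN _ h.2
    · exact hN z hz
  · by_cases hz : z = w
    · subst hz
      rw [hN', Function.update_self, Finset.card_insert_of_notMem (by simp [hwv']),
        Finset.card_erase_add_one hwu]
    · simp [hN', hz]
  · refine Finset.sum_lt_sum (fun x _ => ?_) ⟨u, Finset.mem_univ u, by omega⟩
    by_cases hx : x = v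
    · subst hx; omega
    · exact Nat.sub_le_sub_right (Finset.card_le_card (hsub hx)) a

/-- The outdegrees of a loopless digraph whose average indegree is the integer `a` are also
realized by a loopless digraph in which all indegrees are `a`. -/
theorem exists_regular_inNeighbors (a : ℕ) (N : V → Finset V) (hN : ∀ w, w ∉ N w)
    (hsum : ∑ w, (N w).card = ∑ _w : V, a) :
    ∃ N' : V → Finset V, (∀ w, w ∉ N' w) ∧ (∀ w, (N' w).card = (N w).card) ∧
      ∀ v, (inNeighbors N' v).card = a := by
  induction hk : ∑ x, ((inNeighbors N x).card - a) using Nat.strong_induction_on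
    generalizing N with
  | _ k ih =>
    have hin := (sum_card_inNeighbors N).trans hsum
    by_cases hle : ∀ u, (inNeighbors N u).card ≤ a
    · exact ⟨N, hN, fun _ => rfl, fun v =>
        (Finset.sum_eq_sum_iff_of_le fun u _ => hle u).1 hin v (Finset.mem_univ v)⟩
    · push Not at hle
      obtain ⟨u, hu⟩ := hle
      obtain ⟨v, hv⟩ : ∃ v, (inNeighbors N v).card < a := by
        by_contra! h
        exact (Finset.sum_lt_sum (fun v _ => h v) ⟨u, Finset.mem_univ u, hu⟩).ne' hin
      obtain ⟨M, hM, hcard, hlt⟩ := exists_sum_excess_lt hN hu hv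
      obtain ⟨N', hN', hcard', hreg⟩ := ih _ (hk ▸ hlt) M hM (by simpa [hcard] using hsum) rfl
      exact ⟨N', hN', fun w => (hcard' w).trans (hcard w), hreg⟩

end OutNeighbors

/-- Semi-regular sequences are always realizable: if `∑ a i = ∑ b i`, the indegree
component is regular (`a` constant) and `b i ≤ n - 1` for all `i`, then `S` is a
digraph sequence. -/
theorem semiregular_is_digraph_seq {n : ℕ} (a b : Fin n → ℕ)
    (hsum : ∑ i, a i = ∑ i, b i)
    (hreg : ∀ i j : Fin n, a i = a j)
    (hb : ∀ i : Fin n, b i ≤ n - 1) :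
    IsDigraphSeq a b := by
  have hout (w : Fin n) :
      ∃ t ⊆ Finset.univ.erase w, t.card = b w :=
    Finset.exists_subset_card_eq (by simpa using hb w)
  choose N hsub hcard using hout
  rcases isEmpty_or_nonempty (Fin n) with _ | ⟨⟨i₀⟩⟩
  · exact ⟨fun _ _ => false, isEmptyElim, isEmptyElim, isEmptyElim⟩
  obtain ⟨N', hloop, hcard', hin⟩ := exists_regular_inNeighbors (a i₀) N
    (fun w hw => Finset.notMem_erase w _ (hsub w hw))
    (by simp only [hcard, ← hsum, fun i => hreg i i₀])
  refine ⟨fun i j => decide (j ∈ N' i), by simpa using hloop, fun i => ?_, fun i => ?_⟩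
  · simpa [inNeighbors, hreg i i₀] using hin i
  · simpa [hcard] using hcard' i
end
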